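/- arXiv:2201.02342 — 2 statements merged into one kernel-verified Lean document; each statement's English description precedes it below -/
import Mathlib

section
/- Let λ > 0 and suppose H : closure(Ω) × ℝ² → ℝ is continuous and there exist ξ > 2θ_max, C₁ > 0 and C₂ ≥ 0 such that H(x,W) ≥ C₁ |W|^ξ − C₂ for all x ∈ closure(Ω) and W ∈ ℝ². Then for every pair W = (u,v) of smooth functions with compact support in Ω, not both identically zero, one has J_λ(tW) → −∞ as t → +∞. In particular, for every ρ > 0 there exists a pair E₀ of smooth compactly supported functions with ‖E₀‖ > ρ and J_λ(E₀) < 0. -/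
open MeasureTheory Real Filter

noncomputable def gnorm (Ω : Set (ℝ × ℝ)) (u : (ℝ × ℝ) → ℝ) : ℝ :=
  Real.sqrt (∫ x in Ω, ‖fderiv ℝ u x‖ ^ 2)

noncomputable def pnorm (Ω : Set (ℝ × ℝ)) (u v : (ℝ × ℝ) → ℝ) : ℝ :=
  Real.sqrt ((gnorm Ω u) ^ 2 + (gnorm Ω v) ^ 2)

def IsTest (Ω : Set (ℝ × ℝ)) (u : (ℝ × ℝ) → ℝ) : Prop :=
  ContDiff ℝ (⊤ : ℕ∞) u ∧ HasCompactSupport u ∧ tsupport u ⊆ Ω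

noncomputable def Jfun (Ω : Set (ℝ × ℝ)) (a₁ a₂ b₁ b₂ θ₁ θ₂ lam : ℝ)
    (H : (ℝ × ℝ) → (ℝ × ℝ) → ℝ) (u v : (ℝ × ℝ) → ℝ) : ℝ :=
  (1/2) * (a₁ * (gnorm Ω u) ^ 2 + (b₁/θ₁) * (gnorm Ω u) ^ (2*θ₁))
  + (1/2) * (a₂ * (gnorm Ω v) ^ 2 + (b₂/θ₂) * (gnorm Ω v) ^ (2*θ₂))
  - lam * ∫ x in Ω, H x (u x, v x)

lemma IsTest.const_mul {Ω : Set (ℝ × ℝ)} {u : (ℝ × ℝ) → ℝ} (hu : IsTest Ω u) (t : ℝ) :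
    IsTest Ω (fun x => t * u x) :=
  ⟨contDiff_const.mul hu.1, hu.2.1.mul_left,
    (closure_mono fun _ hx => right_ne_zero_of_mul hx).trans hu.2.2⟩

lemma IsTest.eq_zero_of_notMem {Ω : Set (ℝ × ℝ)} {u : (ℝ × ℝ) → ℝ} (hu : IsTest Ω u)
    {x : ℝ × ℝ} (hx : x ∉ Ω) : u x = 0 :=
  image_eq_zero_of_notMem_tsupport fun h => hx (hu.2.2 h)

lemma gnorm_nonneg (Ω : Set (ℝ × ℝ)) (u : (ℝ × ℝ) → ℝ) : 0 ≤ gnorm Ω u :=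
  Real.sqrt_nonneg _

lemma gnorm_const_mul {Ω : Set (ℝ × ℝ)} {u : (ℝ × ℝ) → ℝ} (hu : Differentiable ℝ u)
    {t : ℝ} (ht : 0 ≤ t) : gnorm Ω (fun x => t * u x) = t * gnorm Ω u := by
  have h : ∀ x, ‖fderiv ℝ (fun y => t * u y) x‖ ^ 2 = t ^ 2 * ‖fderiv ℝ u x‖ ^ 2 := fun x => by
    rw [fderiv_const_mul (hu x), norm_smul, mul_pow, Real.norm_eq_abs, sq_abs]
  simp only [gnorm, h]
  rw [integral_const_mul, Real.sqrt_mul (sq_nonneg t), Real.sqrt_sq ht]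

lemma gnorm_pos {Ω : Set (ℝ × ℝ)} {u : (ℝ × ℝ) → ℝ} (hu : IsTest Ω u)
    (h0 : ∃ x, u x ≠ 0) : 0 < gnorm Ω u := by
  obtain ⟨hc, hs, hsub⟩ := hu
  have hd : Continuous (fderiv ℝ u) := hc.continuous_fderiv (by simp)
  have hne : ∃ x, fderiv ℝ u x ≠ 0 := by
    by_contra! h
    obtain ⟨x, hx⟩ := h0
    have huniv : tsupport u = Set.univ := by
      refine Set.eq_univ_of_forall fun y => subset_tsupport u ?_
      rw [Function.mem_support, is_const_of_fderiv_eq_zero (hc.differentiable (by simp)) h y x]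
      exact hx
    exact noncompact_univ (ℝ × ℝ) (huniv ▸ hs)
  obtain ⟨x, hx⟩ := hne
  refine Real.sqrt_pos.2 ?_
  rw [setIntegral_eq_integral_of_forall_compl_eq_zero]
  · have hsupp : HasCompactSupport fun x => ‖fderiv ℝ u x‖ ^ 2 :=
      (hs.fderiv (𝕜 := ℝ)).comp_left (g := fun L : (ℝ × ℝ) →L[ℝ] ℝ => ‖L‖ ^ 2) (by simp)
    exact (hd.norm.pow 2).integral_pos_of_hasCompactSupport_nonneg_nonzero hsupp
      (fun _ => by positivity) (x := x) (by simpa using hx)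
  · intro y hy
    have : fderiv ℝ u y = 0 := by
      by_contra hne
      exact hy (hsub (support_fderiv_subset ℝ hne))
    simp [this]

lemma setIntegral_sqrt_rpow_pos {Ω : Set (ℝ × ℝ)} {u v : (ℝ × ℝ) → ℝ} (hu : IsTest Ω u)
    (hv : IsTest Ω v) (h0 : ∃ x, u x ≠ 0 ∨ v x ≠ 0) {ξ : ℝ} (hξ : 0 < ξ) :
    Integrable (fun x => Real.sqrt (u x ^ 2 + v x ^ 2) ^ ξ) ∧
      0 < ∫ x in Ω, Real.sqrt (u x ^ 2 + v x ^ 2) ^ ξ := by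
  have hcont : Continuous fun x => Real.sqrt (u x ^ 2 + v x ^ 2) ^ ξ :=
    (((hu.1.continuous.pow 2).add (hv.1.continuous.pow 2)).sqrt).rpow_const
      fun _ => Or.inr hξ.le
  have hsupp : HasCompactSupport fun x => Real.sqrt (u x ^ 2 + v x ^ 2) ^ ξ := by
    refine HasCompactSupport.intro (hu.2.1.isCompact.union hv.2.1.isCompact) fun x hx => ?_
    rw [Set.mem_union, not_or] at hx
    simp [image_eq_zero_of_notMem_tsupport hx.1, image_eq_zero_of_notMem_tsupport hx.2, hξ.ne']
  refine ⟨hcont.integrable_of_hasCompactSupport hsupp, ?_⟩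
  rw [setIntegral_eq_integral_of_forall_compl_eq_zero]
  · obtain ⟨x, hx⟩ := h0
    refine hcont.integral_pos_of_hasCompactSupport_nonneg_nonzero hsupp
      (fun _ => by positivity) (x := x) ?_
    have : 0 < u x ^ 2 + v x ^ 2 := by
      rcases hx with h | h <;> positivity
    positivity
  · intro x hx
    simp [hu.eq_zero_of_notMem hx, hv.eq_zero_of_notMem hx, hξ.ne']

lemma mul_rpow_le_setIntegral {Ω : Set (ℝ × ℝ)} (hop : IsOpen Ω) (hbd : Bornology.IsBounded Ω)
    {H : (ℝ × ℝ) → (ℝ × ℝ) → ℝ}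
    (hHc : ContinuousOn (fun p : (ℝ × ℝ) × (ℝ × ℝ) => H p.1 p.2) (closure Ω ×ˢ Set.univ))
    {ξ C₁ C₂ : ℝ}
    (hlow : ∀ x ∈ closure Ω, ∀ W : ℝ × ℝ,
      C₁ * (Real.sqrt (W.1 ^ 2 + W.2 ^ 2)) ^ ξ - C₂ ≤ H x W)
    {u v : (ℝ × ℝ) → ℝ} (hu : Continuous u) (hv : Continuous v)
    (hint : Integrable (fun x => Real.sqrt (u x ^ 2 + v x ^ 2) ^ ξ)) {t : ℝ} (ht : 0 ≤ t) :
    C₁ * (∫ x in Ω, Real.sqrt (u x ^ 2 + v x ^ 2) ^ ξ) * t ^ ξ - C₂ * volume.real Ω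
      ≤ ∫ x in Ω, H x (t * u x, t * v x) := by
  have hfin : volume Ω ≠ ⊤ := hbd.measure_lt_top.ne
  have hHint : IntegrableOn (fun x => H x (t * u x, t * v x)) Ω := by
    have hco : ContinuousOn (fun x => H x (t * u x, t * v x)) (closure Ω) :=
      hHc.comp (f := fun x => (x, (t * u x, t * v x))) (by fun_prop)
        fun x hx => ⟨hx, Set.mem_univ _⟩
    exact (hco.integrableOn_compact hbd.isCompact_closure).mono_set subset_closure
  have hcint : IntegrableOn (fun _ : ℝ × ℝ => C₂) Ω := integrableOn_const hfin
  have hpint : IntegrableOn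
      (fun x => C₁ * t ^ ξ * Real.sqrt (u x ^ 2 + v x ^ 2) ^ ξ) Ω :=
    hint.integrableOn.const_mul _
  calc C₁ * (∫ x in Ω, Real.sqrt (u x ^ 2 + v x ^ 2) ^ ξ) * t ^ ξ - C₂ * volume.real Ω
      = ∫ x in Ω, (C₁ * t ^ ξ * Real.sqrt (u x ^ 2 + v x ^ 2) ^ ξ - C₂) := by
        rw [integral_sub hpint hcint, integral_const_mul, setIntegral_const, smul_eq_mul]
        ring
    _ ≤ ∫ x in Ω, H x (t * u x, t * v x) := by
        refine setIntegral_mono_on (hpint.sub hcint) hHint hop.measurableSet fun x hx => ?_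
        refine le_trans (le_of_eq ?_) (hlow x (subset_closure hx) _)
        have : Real.sqrt ((t * u x) ^ 2 + (t * v x) ^ 2)
            = t * Real.sqrt (u x ^ 2 + v x ^ 2) := by
          rw [mul_pow, mul_pow, ← mul_add, Real.sqrt_mul (sq_nonneg t), Real.sqrt_sq ht]
        simp only [this]
        rw [Real.mul_rpow ht (Real.sqrt_nonneg _)]
        ring

lemma tendsto_rpow_combination_atBot {p q r ξ : ℝ} (hp : p < ξ) (hq : q < ξ) (hr : r < ξ)
    (hξ : 0 < ξ) (A B C D : ℝ) {c : ℝ} (hc : 0 < c) :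
    Tendsto (fun t : ℝ => A * t ^ p + B * t ^ q + C * t ^ r - c * t ^ ξ + D) atTop atBot := by
  have hlim : ∀ {s : ℝ} (_ : s < ξ) (a : ℝ),
      Tendsto (fun t : ℝ => a * t ^ (-(ξ - s))) atTop (nhds 0) := fun {s} hs a => by
    simpa using (tendsto_rpow_neg_atTop (sub_pos.2 hs)).const_mul a
  have hsum : Tendsto (fun t : ℝ => A * t ^ (-(ξ - p)) + B * t ^ (-(ξ - q))
      + C * t ^ (-(ξ - r)) - c) atTop (nhds (-c)) := by
    simpa using (((hlim hp A).add (hlim hq B)).add (hlim hr C)).sub_const c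
  have hmul := tendsto_atBot_add_const_right atTop D
    ((tendsto_rpow_atTop hξ).atTop_mul_neg (neg_lt_zero.2 hc) hsum)
  refine hmul.congr' ?_
  filter_upwards [eventually_gt_atTop 0] with t ht
  have hpow : ∀ s : ℝ, t ^ s = t ^ ξ * t ^ (-(ξ - s)) := fun s => by
    rw [← Real.rpow_add ht]
    congr 1
    ring
  rw [hpow p, hpow q, hpow r]
  ring

/-- If `H(x,W) ≥ C₁|W|^ξ − C₂` with `ξ > 2θ_max`, then `J_λ(tW) → −∞` as `t → +∞` for any
test pair `W` not both identically zero; in particular, for every `ρ > 0` there is a test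
pair `E₀` with `‖E₀‖ > ρ` and `J_λ(E₀) < 0`. -/
theorem stmt_8 (Ω : Set (ℝ × ℝ)) (hne : Ω.Nonempty) (hop : IsOpen Ω)
    (hbd : Bornology.IsBounded Ω)
    (a₁ a₂ b₁ b₂ θ₁ θ₂ lam : ℝ)
    (ha₁ : 0 < a₁) (ha₂ : 0 < a₂) (hb₁ : 0 < b₁) (hb₂ : 0 < b₂)
    (hθ₁ : 1 < θ₁) (hθ₂ : 1 < θ₂) (hlam : 0 < lam)
    (H : (ℝ × ℝ) → (ℝ × ℝ) → ℝ)
    (hHc : ContinuousOn (fun p : (ℝ × ℝ) × (ℝ × ℝ) => H p.1 p.2) (closure Ω ×ˢ Set.univ))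
    (ξ C₁ C₂ : ℝ) (hξ : 2 * max θ₁ θ₂ < ξ) (hC₁ : 0 < C₁) (hC₂ : 0 ≤ C₂)
    (hlow : ∀ x ∈ closure Ω, ∀ W : ℝ × ℝ,
      C₁ * (Real.sqrt (W.1 ^ 2 + W.2 ^ 2)) ^ ξ - C₂ ≤ H x W) :
    (∀ u v : (ℝ × ℝ) → ℝ, IsTest Ω u → IsTest Ω v →
      (u ≠ (fun _ => 0) ∨ v ≠ (fun _ => 0)) →
      Tendsto (fun t : ℝ =>
        Jfun Ω a₁ a₂ b₁ b₂ θ₁ θ₂ lam H (fun x => t * u x) (fun x => t * v x)) atTop atBot) ∧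
    (∀ ρ > (0 : ℝ), ∃ u v : (ℝ × ℝ) → ℝ, IsTest Ω u ∧ IsTest Ω v ∧
      ρ < pnorm Ω u v ∧ Jfun Ω a₁ a₂ b₁ b₂ θ₁ θ₂ lam H u v < 0) := by
  have hξ₁ : 2 * θ₁ < ξ := by linarith [le_max_left θ₁ θ₂]
  have hξ₂ : 2 * θ₂ < ξ := by linarith [le_max_right θ₁ θ₂]
  have hξ0 : 0 < ξ := by linarith
  have hJ : ∀ u v : (ℝ × ℝ) → ℝ, IsTest Ω u → IsTest Ω v →
      (u ≠ (fun _ => 0) ∨ v ≠ (fun _ => 0)) →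
      Tendsto (fun t : ℝ =>
        Jfun Ω a₁ a₂ b₁ b₂ θ₁ θ₂ lam H (fun x => t * u x) (fun x => t * v x)) atTop atBot := by
    intro u v hu hv huv
    have h0 : ∃ x, u x ≠ 0 ∨ v x ≠ 0 := by
      rcases huv with h | h
      · obtain ⟨x, hx⟩ := Function.ne_iff.1 h
        exact ⟨x, Or.inl hx⟩
      · obtain ⟨x, hx⟩ := Function.ne_iff.1 h
        exact ⟨x, Or.inr hx⟩
    obtain ⟨hint, hpos⟩ := setIntegral_sqrt_rpow_pos hu hv h0 hξ0
    refine tendsto_atBot_mono' atTop ?_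
      (tendsto_rpow_combination_atBot (p := 2) (by linarith) hξ₁ hξ₂ hξ0
        ((1/2) * (a₁ * gnorm Ω u ^ 2 + a₂ * gnorm Ω v ^ 2))
        ((1/2) * ((b₁/θ₁) * gnorm Ω u ^ (2*θ₁))) ((1/2) * ((b₂/θ₂) * gnorm Ω v ^ (2*θ₂)))
        (lam * (C₂ * volume.real Ω)) (mul_pos hlam (mul_pos hC₁ hpos)))
    filter_upwards [eventually_ge_atTop 0] with t ht
    have hle := mul_le_mul_of_nonneg_left (mul_rpow_le_setIntegral hop hbd hHc hlow
      hu.1.continuous hv.1.continuous hint ht) hlam.le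
    simp only [Jfun]
    rw [gnorm_const_mul (hu.1.differentiable (by simp)) ht,
      gnorm_const_mul (hv.1.differentiable (by simp)) ht,
      Real.mul_rpow ht (gnorm_nonneg Ω u), Real.mul_rpow ht (gnorm_nonneg Ω v), Real.rpow_two]
    linarith
  refine ⟨hJ, fun ρ hρ => ?_⟩
  obtain ⟨x, hx⟩ := hne
  obtain ⟨u, hsub, hcs, hcd, -, hux⟩ :=
    exists_contDiff_tsupport_subset (n := ⊤) (hop.mem_nhds hx)
  have hu : IsTest Ω u := ⟨hcd, hcs, hsub⟩
  have hux0 : u x ≠ 0 := by simp [hux]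
  have hg : 0 < gnorm Ω u := gnorm_pos hu ⟨x, hux0⟩
  have htend := hJ u u hu hu (Or.inl fun h => hux0 (congrFun h x))
  obtain ⟨t, htneg, ht0, htρ⟩ := ((htend.eventually_lt_atBot 0).and
    ((eventually_ge_atTop 0).and (eventually_gt_atTop (ρ / gnorm Ω u)))).exists
  refine ⟨_, _, hu.const_mul t, hu.const_mul t, ?_, htneg⟩
  rw [pnorm, gnorm_const_mul (hu.1.differentiable (by simp)) ht0]
  refine Real.lt_sqrt_of_sq_lt ?_
  have : ρ < t * gnorm Ω u := (div_lt_iff₀ hg).1 htρ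
  nlinarith
end

section
/- Assume Moser's inequality hypothesis and the Poincaré hypothesis: there exists λ₁ > 0 such that λ₁ ∫_Ω (u² + v²) dx ≤ ‖(u,v)‖² for all pairs (u,v) of smooth functions with compact support in Ω. Suppose there exist β > 0 and C > 0 such that 0 ≤ H(x,W) ≤ ((a_min + 1)/2) |W|² + C |W|² exp(β |W|²) for all x ∈ closure(Ω) and W ∈ ℝ². Then there exists a constant C_* > 0 such that for every λ > 0 and every pair W of smooth functions with compact support in Ω satisfying ‖W‖² ≤ min{1, 2π/β}, one has J_λ(W) ≥ (b_min / (2 θ_max (2^{θ_max} − 1))) ‖W‖^{2θ_max} − λ C_* ‖W‖². -/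
open MeasureTheory Real Filter

lemma IsTest.const_smul {Ω : Set (ℝ × ℝ)} {u : (ℝ × ℝ) → ℝ} (hu : IsTest Ω u) (c : ℝ) :
    IsTest Ω (c • u) :=
  ⟨contDiff_const.smul hu.1, hu.2.1.smul_left (f := fun _ => c),
    (tsupport_smul_subset_right (fun _ => c) u).trans hu.2.2⟩

lemma isTest_zero (Ω : Set (ℝ × ℝ)) : IsTest Ω 0 :=
  ⟨contDiff_const, HasCompactSupport.zero, by simp [tsupport]⟩

lemma gnorm_zero (Ω : Set (ℝ × ℝ)) : gnorm Ω 0 = 0 := by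
  simp [gnorm]

lemma pnorm_sq (Ω : Set (ℝ × ℝ)) (u v : (ℝ × ℝ) → ℝ) :
    pnorm Ω u v ^ 2 = gnorm Ω u ^ 2 + gnorm Ω v ^ 2 :=
  Real.sq_sqrt (by positivity)

lemma gnorm_const_smul {Ω : Set (ℝ × ℝ)} {u : (ℝ × ℝ) → ℝ} (hu : IsTest Ω u) (c : ℝ) :
    gnorm Ω (c • u) = |c| * gnorm Ω u := by
  have h (x : ℝ × ℝ) : ‖fderiv ℝ (c • u) x‖ ^ 2 = c ^ 2 * ‖fderiv ℝ u x‖ ^ 2 := by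
    rw [fderiv_const_smul ((hu.1.differentiable (by simp)) x), norm_smul, mul_pow,
      Real.norm_eq_abs, sq_abs]
  simp only [gnorm, h]
  rw [integral_const_mul, Real.sqrt_mul (sq_nonneg c), Real.sqrt_sq_eq_abs]

lemma Continuous.integrableOn_of_isBounded {Ω : Set (ℝ × ℝ)} (hbd : Bornology.IsBounded Ω)
    {f : (ℝ × ℝ) → ℝ} (hf : Continuous f) : IntegrableOn f Ω :=
  (hf.continuousOn.integrableOn_compact hbd.isCompact_closure).mono_set subset_closure

/-- Under a Poincaré inequality, a test function is almost everywhere its norm times a test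
function in the unit ball. -/
lemma exists_normalized {Ω : Set (ℝ × ℝ)} (hbd : Bornology.IsBounded Ω)
    {lam1 : ℝ} (hlam1 : 0 < lam1)
    (poincare : ∀ u v : (ℝ × ℝ) → ℝ, IsTest Ω u → IsTest Ω v →
      lam1 * ∫ x in Ω, ((u x) ^ 2 + (v x) ^ 2) ≤ (pnorm Ω u v) ^ 2)
    {u : (ℝ × ℝ) → ℝ} (hu : IsTest Ω u) :
    ∃ w, IsTest Ω w ∧ gnorm Ω w ≤ 1 ∧ ∀ᵐ x ∂volume.restrict Ω, u x = gnorm Ω u * w x := by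
  by_cases h0 : gnorm Ω u = 0
  · refine ⟨0, isTest_zero Ω, by simp [gnorm_zero], ?_⟩
    have hp := poincare u 0 hu (isTest_zero Ω)
    rw [pnorm_sq, h0, gnorm_zero] at hp
    simp only [Pi.zero_apply, ne_eq, OfNat.ofNat_ne_zero, not_false_eq_true, zero_pow,
      add_zero] at hp
    have hint : IntegrableOn (fun x => u x ^ 2) Ω :=
      (hu.1.continuous.pow 2).integrableOn_of_isBounded hbd
    have hz : ∫ x in Ω, u x ^ 2 = 0 :=
      le_antisymm (by nlinarith) (integral_nonneg fun x => sq_nonneg _)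
    rw [integral_eq_zero_iff_of_nonneg (fun x => sq_nonneg _) hint] at hz
    filter_upwards [hz] with x hx
    simpa using hx
  · refine ⟨(gnorm Ω u)⁻¹ • u, hu.const_smul _, ?_, Eventually.of_forall fun x => ?_⟩
    · rw [gnorm_const_smul hu, abs_of_nonneg (inv_nonneg.2 (gnorm_nonneg Ω u)),
        inv_mul_cancel₀ h0]
    · simp [mul_inv_cancel_left₀ h0]

/-- Pointwise bound of the growth term by the Moser exponential. -/
lemma growth_le_exp {A C β M S r : ℝ} (hA : 0 ≤ A) (hC : 0 ≤ C) (hβ : 0 < β) (hM : 0 ≤ M)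
    (hr : 0 ≤ r) (hrβ : r ≤ 2 * π / β) (hS : S ≤ r * M) (hS0 : 0 ≤ S) :
    A * S + C * S * exp (β * S) ≤ (A + C) * r * exp (4 * π * M) := by
  have hπ := Real.pi_gt_three
  have h1 : β * S ≤ 2 * π * M := by
    rw [le_div_iff₀ hβ] at hrβ
    nlinarith [mul_le_mul_of_nonneg_left hS hβ.le, mul_le_mul_of_nonneg_right hrβ hM]
  have h2 : M ≤ exp (2 * π * M) := by
    nlinarith [Real.add_one_le_exp (2 * π * M), mul_nonneg hM (by linarith : 0 ≤ π - 3)]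
  have h3 : exp (4 * π * M) = exp (2 * π * M) * exp (2 * π * M) := by
    rw [← Real.exp_add]; ring_nf
  have h4 : 1 ≤ exp (2 * π * M) := Real.one_le_exp (by positivity)
  have h5 : S ≤ r * exp (2 * π * M) := hS.trans (mul_le_mul_of_nonneg_left h2 hr)
  have h6 : S * exp (β * S) ≤ r * exp (4 * π * M) := by
    rw [h3, ← mul_assoc]
    exact mul_le_mul h5 (Real.exp_le_exp.2 h1) (Real.exp_pos _).le (by positivity)
  have h7 : S ≤ S * exp (β * S) := le_mul_of_one_le_right hS0 (Real.one_le_exp (by positivity))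
  nlinarith [mul_le_mul_of_nonneg_left (h7.trans h6) hA, mul_le_mul_of_nonneg_left h6 hC]

lemma div_mul_rpow_le {b c θ θ' s : ℝ} (hc : 0 < c) (hcb : c ≤ b) (hθ : 0 < θ) (hθ' : θ ≤ θ')
    (hs : 0 ≤ s) (hs1 : s ≤ 1) :
    c / θ' * (s ^ 2) ^ θ' ≤ b / θ * s ^ (2 * θ) := by
  have h : s ^ (2 * θ) = (s ^ 2) ^ θ := by
    rw [Real.rpow_mul hs, Real.rpow_two]
  rw [h]
  apply mul_le_mul
  · exact div_le_div₀ (hc.le.trans hcb) hcb hθ hθ'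
  · exact Real.rpow_le_rpow_of_exponent_ge' (sq_nonneg s) (pow_le_one₀ hs hs1) hθ.le hθ'
  · positivity
  · exact div_nonneg (hc.le.trans hcb) hθ.le

lemma add_rpow_le_two_rpow_sub_one {p q θ : ℝ} (hp : 0 ≤ p) (hq : 0 ≤ q) (hθ : 1 ≤ θ) :
    (p + q) ^ θ ≤ ((2 : ℝ) ^ θ - 1) * (p ^ θ + q ^ θ) := by
  have h1 : (p + q) ^ θ ≤ 2 ^ (θ - 1) * (p ^ θ + q ^ θ) := by
    exact_mod_cast NNReal.rpow_add_le_mul_rpow_add_rpow ⟨p, hp⟩ ⟨q, hq⟩ hθ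
  have h2 : (2 : ℝ) ^ (θ - 1) ≤ 2 ^ θ - 1 := by
    have h3 : (1 : ℝ) ≤ 2 ^ (θ - 1) := Real.one_le_rpow (by norm_num) (by linarith)
    have h4 : (2 : ℝ) ^ θ = 2 ^ (θ - 1) * 2 := by
      rw [← Real.rpow_add_one (by norm_num)]; ring_nf
    linarith
  exact h1.trans (mul_le_mul_of_nonneg_right h2 (by positivity))

/-- Key lower bound for `J_λ` on a small ball: under the Moser and Poincaré hypotheses and
the growth bound `0 ≤ H(x,W) ≤ ((a_min+1)/2)|W|² + C|W|² exp(β|W|²)`, there is `C_* > 0`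
with `J_λ(W) ≥ (b_min/(2θ_max(2^{θ_max}−1))) ‖W‖^{2θ_max} − λ C_* ‖W‖²` whenever
`‖W‖² ≤ min{1, 2π/β}`. -/
theorem stmt_11 (Ω : Set (ℝ × ℝ)) (hne : Ω.Nonempty) (hop : IsOpen Ω)
    (hbd : Bornology.IsBounded Ω)
    (a₁ a₂ b₁ b₂ θ₁ θ₂ : ℝ)
    (ha₁ : 0 < a₁) (ha₂ : 0 < a₂) (hb₁ : 0 < b₁) (hb₂ : 0 < b₂)
    (hθ₁ : 1 < θ₁) (hθ₂ : 1 < θ₂)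
    (CΩ : ℝ) (hCΩ : 0 < CΩ)
    (moser : ∀ u : (ℝ × ℝ) → ℝ, IsTest Ω u → gnorm Ω u ≤ 1 →
      ∫ x in Ω, Real.exp (4 * Real.pi * (u x) ^ 2) ≤ CΩ)
    (lam1 : ℝ) (hlam1 : 0 < lam1)
    (poincare : ∀ u v : (ℝ × ℝ) → ℝ, IsTest Ω u → IsTest Ω v →
      lam1 * ∫ x in Ω, ((u x) ^ 2 + (v x) ^ 2) ≤ (pnorm Ω u v) ^ 2)
    (H : (ℝ × ℝ) → (ℝ × ℝ) → ℝ)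
    (β C : ℝ) (hβ : 0 < β) (hC : 0 < C)
    (hH : ∀ x ∈ closure Ω, ∀ W : ℝ × ℝ, 0 ≤ H x W ∧
      H x W ≤ (min a₁ a₂ + 1) / 2 * (W.1 ^ 2 + W.2 ^ 2)
        + C * (W.1 ^ 2 + W.2 ^ 2) * Real.exp (β * (W.1 ^ 2 + W.2 ^ 2))) :
    ∃ Cs > (0 : ℝ), ∀ lam > (0 : ℝ), ∀ u v : (ℝ × ℝ) → ℝ, IsTest Ω u → IsTest Ω v →
      (pnorm Ω u v) ^ 2 ≤ min 1 (2 * Real.pi / β) →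
      min b₁ b₂ / (2 * max θ₁ θ₂ * ((2 : ℝ) ^ (max θ₁ θ₂) - 1))
          * (pnorm Ω u v) ^ (2 * max θ₁ θ₂)
        - lam * Cs * (pnorm Ω u v) ^ 2
      ≤ Jfun Ω a₁ a₂ b₁ b₂ θ₁ θ₂ lam H u v := by
  have hA : 0 < (min a₁ a₂ + 1) / 2 := by
    have := lt_min ha₁ ha₂
    positivity
  set A := (min a₁ a₂ + 1) / 2
  refine ⟨(A + C) * (2 * CΩ), by positivity, fun lam hlam u v hu hv hW => ?_⟩
  have hW1 : pnorm Ω u v ^ 2 ≤ 1 := hW.trans (min_le_left _ _)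
  have hW2 : pnorm Ω u v ^ 2 ≤ 2 * π / β := hW.trans (min_le_right _ _)
  have hs := gnorm_nonneg Ω u
  have ht := gnorm_nonneg Ω v
  have hsum := pnorm_sq Ω u v
  have hρ : 0 ≤ pnorm Ω u v := Real.sqrt_nonneg _
  have hHint : ∫ x in Ω, H x (u x, v x) ≤ (A + C) * (2 * CΩ) * pnorm Ω u v ^ 2 := by
    obtain ⟨w, hw, hw1, huw⟩ := exists_normalized hbd hlam1 poincare hu
    obtain ⟨z, hz, hz1, hvz⟩ := exists_normalized hbd hlam1 poincare hv
    have hwi : IntegrableOn (fun x => exp (4 * π * w x ^ 2)) Ω :=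
      Continuous.integrableOn_of_isBounded hbd
        (Real.continuous_exp.comp (continuous_const.mul (hw.1.continuous.pow 2)))
    have hzi : IntegrableOn (fun x => exp (4 * π * z x ^ 2)) Ω :=
      Continuous.integrableOn_of_isBounded hbd
        (Real.continuous_exp.comp (continuous_const.mul (hz.1.continuous.pow 2)))
    have hmono : ∫ x in Ω, H x (u x, v x) ≤ ∫ x in Ω, (A + C) * pnorm Ω u v ^ 2 *
        (exp (4 * π * w x ^ 2) + exp (4 * π * z x ^ 2)) := by
      refine integral_mono_of_nonneg ?_ ((hwi.add hzi).const_mul _) ?_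
      · filter_upwards [ae_restrict_mem hop.measurableSet] with x hx
        exact (hH x (subset_closure hx) _).1
      · filter_upwards [ae_restrict_mem hop.measurableSet, huw, hvz] with x hx hux hvx
        refine (hH x (subset_closure hx) (u x, v x)).2.trans ?_
        have hS : u x ^ 2 + v x ^ 2 ≤ pnorm Ω u v ^ 2 * max (w x ^ 2) (z x ^ 2) := by
          rw [hux, hvx, hsum, add_mul, mul_pow, mul_pow]
          gcongr
          · exact le_max_left _ _
          · exact le_max_right _ _
        refine (growth_le_exp hA.le hC.le hβ (le_max_of_le_left (sq_nonneg _)) (sq_nonneg _)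
          hW2 hS (by positivity)).trans (mul_le_mul_of_nonneg_left ?_ (by positivity))
        rcases max_choice (w x ^ 2) (z x ^ 2) with h | h <;> rw [h]
        · exact le_add_of_nonneg_right (Real.exp_pos _).le
        · exact le_add_of_nonneg_left (Real.exp_pos _).le
    rw [integral_const_mul, integral_add hwi hzi] at hmono
    rw [mul_right_comm]
    refine hmono.trans (mul_le_mul_of_nonneg_left ?_ (by positivity))
    linarith [moser w hw hw1, moser z hz hz1]
  have hθ : 1 < max θ₁ θ₂ := lt_max_of_lt_left hθ₁
  have hb : 0 < min b₁ b₂ := lt_min hb₁ hb₂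
  have hu1 := div_mul_rpow_le hb (min_le_left b₁ b₂) (by linarith) (le_max_left θ₁ θ₂) hs
    (by nlinarith [sq_nonneg (gnorm Ω v)])
  have hv1 := div_mul_rpow_le hb (min_le_right b₁ b₂) (by linarith) (le_max_right θ₁ θ₂) ht
    (by nlinarith [sq_nonneg (gnorm Ω u)])
  set θ := max θ₁ θ₂
  have hpos : 0 < (2 : ℝ) ^ θ - 1 := by
    linarith [Real.one_lt_rpow (by norm_num : (1 : ℝ) < 2) (by linarith : 0 < θ)]
  have hmain : min b₁ b₂ / (2 * θ * ((2 : ℝ) ^ θ - 1)) * pnorm Ω u v ^ (2 * θ) ≤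
      1 / 2 * (min b₁ b₂ / θ * (gnorm Ω u ^ 2) ^ θ + min b₁ b₂ / θ * (gnorm Ω v ^ 2) ^ θ) := by
    rw [Real.rpow_mul hρ, Real.rpow_two, hsum]
    refine (mul_le_mul_of_nonneg_left (add_rpow_le_two_rpow_sub_one (sq_nonneg (gnorm Ω u))
      (sq_nonneg (gnorm Ω v)) hθ.le) (by positivity)).trans (le_of_eq ?_)
    field_simp
  have hlamH := mul_le_mul_of_nonneg_left hHint hlam.le
  have hau : 0 ≤ a₁ * gnorm Ω u ^ 2 := by positivity
  have hav : 0 ≤ a₂ * gnorm Ω v ^ 2 := by positivity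
  unfold Jfun
  linarith
end
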